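/- arXiv:2307.12968 — 4 statements merged into one kernel-verified Lean document; each statement's English description precedes it below -/
import Mathlib

section
/- (Lemma 2.) Let π and β be policies with π s a > 0 and β s a > 0 for all s, a, and define (U Q)(s,a) = ( r s a + γ · ∑_{s'} P s a s' · ∑_{a'} π s' a' · Q(s',a') ) · (β s a / π s a). Fix any Q₀ : S × A → ℝ and define Q_{t+1} = U Q_t. Then for every state s and action a, Q_t(s,a) converges as t → ∞ to Q^β(s,a) · β s a / π s a, where Q^β is the unique fixed point of the Bellman evaluation operator T_β. -/
open Finset Filter Topology

/-- An average against probability weights is bounded by any bound on the averaged function. -/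
theorem abs_sum_mul_le_of_sum_eq_one {ι : Type*} [Fintype ι] {w f : ι → ℝ} {C : ℝ}
    (hw0 : ∀ i, 0 ≤ w i) (hw1 : ∑ i, w i = 1) (hf : ∀ i, |f i| ≤ C) :
    |∑ i, w i * f i| ≤ C :=
  calc |∑ i, w i * f i| ≤ ∑ i, |w i * f i| := abs_sum_le_sum_abs _ _
    _ ≤ ∑ i, w i * C := by
      refine sum_le_sum fun i _ => ?_
      rw [abs_mul, abs_of_nonneg (hw0 i)]
      exact mul_le_mul_of_nonneg_left (hf i) (hw0 i)
    _ = C := by rw [← sum_mul, hw1, one_mul]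

/-- Iterating the discounted evaluation operator with zero reward drives every function to zero. -/
theorem tendsto_zero_of_discounted_average {S A : Type*} [Fintype S] [Fintype A]
    {P : S → A → S → ℝ} (hP0 : ∀ s a s', 0 ≤ P s a s') (hP1 : ∀ s a, ∑ s', P s a s' = 1)
    {β : S → A → ℝ} (hβ0 : ∀ s a, 0 ≤ β s a) (hβ1 : ∀ s, ∑ a, β s a = 1)
    {γ : ℝ} (hγ0 : 0 ≤ γ) (hγ1 : γ < 1) {D : ℕ → S → A → ℝ}
    (hD : ∀ t s a, D (t + 1) s a = γ * ∑ s', P s a s' * ∑ a', β s' a' * D t s' a') (s : S) (a : A) :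
    Tendsto (fun t => D t s a) atTop (𝓝 0) := by
  obtain ⟨C, hC⟩ : ∃ C, ∀ s a, |D 0 s a| ≤ C :=
    ⟨∑ s, ∑ a, |D 0 s a|, fun s a =>
      (single_le_sum (f := fun a => |D 0 s a|) (fun _ _ => abs_nonneg _) (mem_univ a)).trans
        (single_le_sum (f := fun s => ∑ a, |D 0 s a|)
          (fun _ _ => sum_nonneg fun _ _ => abs_nonneg _) (mem_univ s))⟩
  have hbound : ∀ t s a, |D t s a| ≤ γ ^ t * C := by
    intro t
    induction t with
    | zero => simpa using hC
    | succ t ih =>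
      intro s a
      rw [hD, abs_mul, abs_of_nonneg hγ0, pow_succ', mul_assoc]
      exact mul_le_mul_of_nonneg_left
        (abs_sum_mul_le_of_sum_eq_one (hP0 s a) (hP1 s a) fun s' =>
          abs_sum_mul_le_of_sum_eq_one (hβ0 s') (hβ1 s') (ih s')) hγ0
  refine squeeze_zero_norm (fun t => hbound t s a) ?_
  simpa using (tendsto_pow_atTop_nhds_zero_of_lt_one hγ0 hγ1).mul_const C

/-- Lemma 2: the iterates of the regularized critic operator `U` converge
pointwise to `Q^β(s,a) · β(a|s) / π(a|s)`. -/
theorem regularized_critic_iterates_converge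
    {S A : Type*} [Fintype S] [Fintype A] [Nonempty S] [Nonempty A]
    (P : S → A → S → ℝ) (hP0 : ∀ s a s', 0 ≤ P s a s')
    (hP1 : ∀ s a, ∑ s', P s a s' = 1)
    (π : S → A → ℝ) (hπ0 : ∀ s a, 0 < π s a) (hπ1 : ∀ s, ∑ a, π s a = 1)
    (β : S → A → ℝ) (hβ0 : ∀ s a, 0 < β s a) (hβ1 : ∀ s, ∑ a, β s a = 1)
    (r : S → A → ℝ) (γ : ℝ) (hγ0 : 0 ≤ γ) (hγ1 : γ < 1)
    (Qβ : S × A → ℝ)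
    (hQβ : ∀ s a,
      Qβ (s, a) = r s a + γ * ∑ s', P s a s' * ∑ a', β s' a' * Qβ (s', a'))
    (Q₀ : S × A → ℝ) (Qseq : ℕ → S × A → ℝ) (hQ0 : Qseq 0 = Q₀)
    (hstep : ∀ t s a, Qseq (t + 1) (s, a) =
      (r s a + γ * ∑ s', P s a s' * ∑ a', π s' a' * Qseq t (s', a')) * (β s a / π s a)) :
    ∀ s a, Tendsto (fun t => Qseq t (s, a)) atTop (𝓝 (Qβ (s, a) * β s a / π s a)) := by
  intro s a
  have hcancel : ∀ t s a, β s a * (Qseq t (s, a) * π s a / β s a - Qβ (s, a)) =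
      π s a * Qseq t (s, a) - β s a * Qβ (s, a) := by
    intro t s a
    have := (hβ0 s a).ne'
    field_simp
  have hlim := tendsto_zero_of_discounted_average hP0 hP1 (fun s a => (hβ0 s a).le) hβ1 hγ0 hγ1
    (D := fun t s a => Qseq t (s, a) * π s a / β s a - Qβ (s, a)) (fun t s a => by
      have hβ := (hβ0 s a).ne'
      have hπ := (hπ0 s a).ne'
      simp only [hcancel, sum_sub_distrib, mul_sub]
      rw [hstep, hQβ]
      field_simp
      ring) s a
  have hlim' := (hlim.add_const (Qβ (s, a))).mul_const (β s a / π s a)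
  rw [zero_add, ← mul_div_assoc] at hlim'
  refine hlim'.congr fun t => ?_
  have hβ := (hβ0 s a).ne'
  have hπ := (hπ0 s a).ne'
  field_simp
  ring
end

section
/- Let π and β be policies with π s a > 0 and β s a > 0 for all s, a, and define (U Q)(s,a) = ( r s a + γ · ∑_{s'} P s a s' · ∑_{a'} π s' a' · Q(s',a') ) · (β s a / π s a). Then U has exactly one fixed point, namely the function Q*(s,a) = Q^β(s,a) · β s a / π s a, where Q^β is the unique fixed point of the Bellman evaluation operator T_β. -/
open Finset

/-- A function equal to `γ < 1` times its own expected value after one transition vanishes. -/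
theorem eq_zero_of_eq_discounted_expectation
    {S A : Type*} [Fintype S] [Fintype A]
    (P : S → A → S → ℝ) (hP0 : ∀ s a s', 0 ≤ P s a s') (hP1 : ∀ s a, ∑ s', P s a s' = 1)
    (μ : S → A → ℝ) (hμ0 : ∀ s a, 0 ≤ μ s a) (hμ1 : ∀ s, ∑ a, μ s a = 1)
    (γ : ℝ) (hγ0 : 0 ≤ γ) (hγ1 : γ < 1) (D : S × A → ℝ)
    (hD : ∀ s a, D (s, a) = γ * ∑ s', P s a s' * ∑ a', μ s' a' * D (s', a')) :
    D = 0 := by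
  have hbound : ∀ s a, |D (s, a)| ≤ γ * ‖D‖ := fun s a => by
    have hinner : ∀ s', |∑ a', μ s' a' * D (s', a')| ≤ ‖D‖ := fun s' =>
      calc |∑ a', μ s' a' * D (s', a')| ≤ ∑ a', |μ s' a' * D (s', a')| :=
            Finset.abs_sum_le_sum_abs _ _
        _ ≤ ∑ a', μ s' a' * ‖D‖ := Finset.sum_le_sum fun a' _ => by
            rw [abs_mul, abs_of_nonneg (hμ0 s' a')]
            exact mul_le_mul_of_nonneg_left (norm_le_pi_norm D (s', a')) (hμ0 s' a')
        _ = ‖D‖ := by rw [← Finset.sum_mul, hμ1, one_mul]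
    rw [hD s a, abs_mul, abs_of_nonneg hγ0]
    refine mul_le_mul_of_nonneg_left ?_ hγ0
    calc |∑ s', P s a s' * ∑ a', μ s' a' * D (s', a')|
        ≤ ∑ s', |P s a s' * ∑ a', μ s' a' * D (s', a')| := Finset.abs_sum_le_sum_abs _ _
      _ ≤ ∑ s', P s a s' * ‖D‖ := Finset.sum_le_sum fun s' _ => by
          rw [abs_mul, abs_of_nonneg (hP0 s a s')]
          exact mul_le_mul_of_nonneg_left (hinner s') (hP0 s a s')
      _ = ‖D‖ := by rw [← Finset.sum_mul, hP1, one_mul]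
  have hnorm : ‖D‖ ≤ γ * ‖D‖ :=
    (pi_norm_le_iff_of_nonneg (mul_nonneg hγ0 (norm_nonneg D))).2 fun x => hbound x.1 x.2
  have : ‖D‖ = 0 := by nlinarith [norm_nonneg D]
  exact norm_eq_zero.1 this

/-- The Bellman evaluation operator of a policy has at most one fixed point. -/
theorem bellman_fixed_point_unique
    {S A : Type*} [Fintype S] [Fintype A]
    (P : S → A → S → ℝ) (hP0 : ∀ s a s', 0 ≤ P s a s') (hP1 : ∀ s a, ∑ s', P s a s' = 1)
    (μ : S → A → ℝ) (hμ0 : ∀ s a, 0 ≤ μ s a) (hμ1 : ∀ s, ∑ a, μ s a = 1)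
    (r : S → A → ℝ) (γ : ℝ) (hγ0 : 0 ≤ γ) (hγ1 : γ < 1) (Q Q' : S × A → ℝ)
    (hQ : ∀ s a, Q (s, a) = r s a + γ * ∑ s', P s a s' * ∑ a', μ s' a' * Q (s', a'))
    (hQ' : ∀ s a, Q' (s, a) = r s a + γ * ∑ s', P s a s' * ∑ a', μ s' a' * Q' (s', a')) :
    Q = Q' := by
  refine sub_eq_zero.1
    (eq_zero_of_eq_discounted_expectation P hP0 hP1 μ hμ0 hμ1 γ hγ0 hγ1 (Q - Q') fun s a => ?_)
  simp only [Pi.sub_apply, mul_sub, Finset.sum_sub_distrib]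
  rw [hQ s a, hQ' s a]
  ring

/-- The regularized critic operator `U` has exactly one fixed point, namely
`Q*(s,a) = Q^β(s,a) · β(a|s) / π(a|s)`. -/
theorem regularized_critic_unique_fixed_point
    {S A : Type*} [Fintype S] [Fintype A] [Nonempty S] [Nonempty A]
    (P : S → A → S → ℝ) (hP0 : ∀ s a s', 0 ≤ P s a s')
    (hP1 : ∀ s a, ∑ s', P s a s' = 1)
    (π : S → A → ℝ) (hπ0 : ∀ s a, 0 < π s a) (hπ1 : ∀ s, ∑ a, π s a = 1)
    (β : S → A → ℝ) (hβ0 : ∀ s a, 0 < β s a) (hβ1 : ∀ s, ∑ a, β s a = 1)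
    (r : S → A → ℝ) (γ : ℝ) (hγ0 : 0 ≤ γ) (hγ1 : γ < 1)
    (Qβ : S × A → ℝ)
    (hQβ : ∀ s a,
      Qβ (s, a) = r s a + γ * ∑ s', P s a s' * ∑ a', β s' a' * Qβ (s', a')) :
    ∀ Q : S × A → ℝ,
      (∀ s a, Q (s, a) =
        (r s a + γ * ∑ s', P s a s' * ∑ a', π s' a' * Q (s', a')) * (β s a / π s a)) ↔
      Q = fun sa => Qβ sa * β sa.1 sa.2 / π sa.1 sa.2 := by
  have hπ : ∀ s a, π s a ≠ 0 := fun s a => (hπ0 s a).ne'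
  have hβ : ∀ s a, β s a ≠ 0 := fun s a => (hβ0 s a).ne'
  intro Q
  constructor
  · intro hQ
    have hcancel : ∀ s a, β s a * (Q (s, a) * π s a / β s a) = π s a * Q (s, a) :=
      fun s a => by
        have := hβ s a
        field_simp
    have heq : (fun sa : S × A => Q sa * π sa.1 sa.2 / β sa.1 sa.2) = Qβ := by
      refine bellman_fixed_point_unique P hP0 hP1 β (fun s a => (hβ0 s a).le) hβ1 r γ hγ0 hγ1
        _ _ (fun s a => ?_) hQβ
      simp only [hcancel]
      have hπsa := hπ s a
      have hβsa := hβ s a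
      rw [hQ s a]
      field_simp
    funext ⟨s, a⟩
    have hπsa := hπ s a
    have hβsa := hβ s a
    rw [← heq]
    field_simp
  · rintro rfl s a
    have hcancel : ∀ s a, π s a * (Qβ (s, a) * β s a / π s a) = β s a * Qβ (s, a) :=
      fun s a => by
        have := hπ s a
        field_simp
    simp only [hcancel]
    rw [← hQβ s a, mul_div_assoc]
end

section
/- (Theorem 1, main result.) Assume r s a > 0 for all s, a. Let π and β be policies with π s a > 0 and β s a > 0 for all s, a. Let Q^β be the unique fixed point of the Bellman evaluation operator T_β, and let Q_r be the unique fixed point of the regularized critic operator (U Q)(s,a) = ( r s a + γ · ∑_{s'} P s a s' · ∑_{a'} π s' a' · Q(s',a') ) · (β s a / π s a). Then for every state s: ∑_{a} π s a · Real.log (Q_r(s,a)) = ∑_{a} π s a · ( Real.log (Q^β(s,a)) + Real.log (β s a) - Real.log (π s a) ). That is, the un-regularized actor objective evaluated with the regularized critic equals the one-step RL actor objective: the behavioral Q-values plus a reverse-KL regularizer toward β. -/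
open Finset

/-- Minimum principle: a function that dominates its discounted expected value under a
policy is nonnegative. -/
theorem nonneg_of_discounted_expectation_le
    {S A : Type*} [Fintype S] [Fintype A] [Nonempty S] [Nonempty A]
    {P : S → A → S → ℝ} (hP0 : ∀ s a s', 0 ≤ P s a s') (hP1 : ∀ s a, ∑ s', P s a s' = 1)
    {μ : S → A → ℝ} (hμ0 : ∀ s a, 0 ≤ μ s a) (hμ1 : ∀ s, ∑ a, μ s a = 1)
    {γ : ℝ} (hγ0 : 0 ≤ γ) (hγ1 : γ < 1) {f : S × A → ℝ}
    (hf : ∀ s a, γ * ∑ s', P s a s' * ∑ a', μ s' a' * f (s', a') ≤ f (s, a)) (x : S × A) :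
    0 ≤ f x := by
  obtain ⟨⟨s₀, a₀⟩, hmin⟩ := Finite.exists_min f
  have hinner (s : S) : f (s₀, a₀) ≤ ∑ a, μ s a * f (s, a) :=
    calc f (s₀, a₀) = ∑ a, μ s a * f (s₀, a₀) := by rw [← sum_mul, hμ1, one_mul]
      _ ≤ _ := sum_le_sum fun a _ => mul_le_mul_of_nonneg_left (hmin _) (hμ0 s a)
  have houter : f (s₀, a₀) ≤ ∑ s', P s₀ a₀ s' * ∑ a', μ s' a' * f (s', a') :=
    calc f (s₀, a₀) = ∑ s', P s₀ a₀ s' * f (s₀, a₀) := by rw [← sum_mul, hP1, one_mul]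
      _ ≤ _ := sum_le_sum fun s' _ => mul_le_mul_of_nonneg_left (hinner s') (hP0 _ _ _)
  have hle := (mul_le_mul_of_nonneg_left houter hγ0).trans (hf s₀ a₀)
  have h0 : 0 ≤ f (s₀, a₀) := by nlinarith
  exact h0.trans (hmin x)

/-- A fixed point of the Bellman evaluation operator lies below any other one. -/
theorem bellman_fixedPoint_le
    {S A : Type*} [Fintype S] [Fintype A] [Nonempty S] [Nonempty A]
    {P : S → A → S → ℝ} (hP0 : ∀ s a s', 0 ≤ P s a s') (hP1 : ∀ s a, ∑ s', P s a s' = 1)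
    {μ : S → A → ℝ} (hμ0 : ∀ s a, 0 ≤ μ s a) (hμ1 : ∀ s, ∑ a, μ s a = 1)
    {r : S → A → ℝ} {γ : ℝ} (hγ0 : 0 ≤ γ) (hγ1 : γ < 1) {f g : S × A → ℝ}
    (hf : ∀ s a, f (s, a) = r s a + γ * ∑ s', P s a s' * ∑ a', μ s' a' * f (s', a'))
    (hg : ∀ s a, g (s, a) = r s a + γ * ∑ s', P s a s' * ∑ a', μ s' a' * g (s', a'))
    (x : S × A) : f x ≤ g x := by
  refine sub_nonneg.1 (nonneg_of_discounted_expectation_le hP0 hP1 hμ0 hμ1 hγ0 hγ1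
    (f := fun x => g x - f x) (fun s a => ?_) x)
  simp only [mul_sub, sum_sub_distrib]
  linarith [hf s a, hg s a]

/-- Theorem 1 (main result): the un-regularized actor objective evaluated with
the regularized critic equals the one-step RL actor objective. -/
theorem one_step_rl_eq_critic_regularization
    {S A : Type*} [Fintype S] [Fintype A] [Nonempty S] [Nonempty A]
    (P : S → A → S → ℝ) (hP0 : ∀ s a s', 0 ≤ P s a s')
    (hP1 : ∀ s a, ∑ s', P s a s' = 1)
    (π : S → A → ℝ) (hπ0 : ∀ s a, 0 < π s a) (hπ1 : ∀ s, ∑ a, π s a = 1)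
    (β : S → A → ℝ) (hβ0 : ∀ s a, 0 < β s a) (hβ1 : ∀ s, ∑ a, β s a = 1)
    (r : S → A → ℝ) (hr : ∀ s a, 0 < r s a)
    (γ : ℝ) (hγ0 : 0 ≤ γ) (hγ1 : γ < 1)
    (Qβ : S × A → ℝ)
    (hQβ : ∀ s a,
      Qβ (s, a) = r s a + γ * ∑ s', P s a s' * ∑ a', β s' a' * Qβ (s', a'))
    (Qr : S × A → ℝ)
    (hQr : ∀ s a, Qr (s, a) =
      (r s a + γ * ∑ s', P s a s' * ∑ a', π s' a' * Qr (s', a')) * (β s a / π s a)) :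
    ∀ s, ∑ a, π s a * Real.log (Qr (s, a)) =
      ∑ a, π s a * (Real.log (Qβ (s, a)) + Real.log (β s a) - Real.log (π s a)) := by
  have hβ0' (s : S) (a : A) : 0 ≤ β s a := (hβ0 s a).le
  have hQβ_pos (s : S) (a : A) : 0 < Qβ (s, a) := by
    have hnonneg := nonneg_of_discounted_expectation_le hP0 hP1 hβ0' hβ1 hγ0 hγ1
      (f := Qβ) fun s a => by linarith [hQβ s a, hr s a]
    rw [hQβ]
    exact add_pos_of_pos_of_nonneg (hr s a) <| mul_nonneg hγ0 <| sum_nonneg fun s' _ =>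
      mul_nonneg (hP0 _ _ _) <| sum_nonneg fun a' _ => mul_nonneg (hβ0' _ _) (hnonneg _)
  let D : S × A → ℝ := fun x => Qr x * (π x.1 x.2 / β x.1 x.2)
  have hβD (s : S) (a : A) : β s a * D (s, a) = π s a * Qr (s, a) := by
    have := (hβ0 s a).ne'
    simp only [D]
    field_simp
  have hD (s : S) (a : A) :
      D (s, a) = r s a + γ * ∑ s', P s a s' * ∑ a', β s' a' * D (s', a') := by
    have hβ := (hβ0 s a).ne'
    have hπ := (hπ0 s a).ne'
    simp only [hβD]
    simp only [D]
    rw [hQr, mul_assoc, div_mul_div_cancel₀ hπ, div_self hβ, mul_one]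
  have hDQ (x : S × A) : D x = Qβ x := le_antisymm
    (bellman_fixedPoint_le hP0 hP1 hβ0' hβ1 hγ0 hγ1 hD hQβ x)
    (bellman_fixedPoint_le hP0 hP1 hβ0' hβ1 hγ0 hγ1 hQβ hD x)
  intro s
  refine sum_congr rfl fun a _ => ?_
  have hQr_eq : Qr (s, a) = Qβ (s, a) * β s a / π s a := by
    rw [eq_div_iff (hπ0 s a).ne', ← hDQ, mul_comm, ← hβD, mul_comm]
  rw [hQr_eq, Real.log_div (mul_pos (hQβ_pos s a) (hβ0 s a)).ne' (hπ0 s a).ne',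
    Real.log_mul (hQβ_pos s a).ne' (hβ0 s a).ne']
end

section
/- (Theorem 3, actor-equivalence part, goal-conditioned setting.) In addition to the hypotheses of the goal-conditioned fixed-point result, assume P s a g > 0 for all s, a, g. Let Q̃^β be the unique fixed point of (T_β^C Q̃)(s,a,g) = (1-γ) · P s a g + γ · ∑_{s'} P s a s' · ∑_{a'} β s' a' · Q̃(s',a',g), and let Q* be the unique fixed point of (U Q)(s,a,g) = ( (1-γ) · P s a g + γ · ∑_{s'} P s a s' · ∑_{a'} π g s' a' · Q(s',a',g) ) · (β s a / π g s a). Then for every state s and goal g: ∑_{a} π g s a · Real.log (Q*(s,a,g)) = ∑_{a} π g s a · ( Real.log (Q̃^β(s,a,g)) + Real.log (β s a) - Real.log (π g s a) ). -/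
open Finset

/-- Minimum principle: a supersolution of the discounted Bellman evaluation equation with zero reward
is nonnegative. -/
theorem nonneg_of_discounted_average_le
    {S A : Type*} [Fintype S] [Fintype A]
    {P : S → A → S → ℝ} (hP0 : ∀ s a s', 0 ≤ P s a s') (hP1 : ∀ s a, ∑ s', P s a s' = 1)
    {β : S → A → ℝ} (hβ0 : ∀ s a, 0 ≤ β s a) (hβ1 : ∀ s, ∑ a, β s a = 1)
    {γ : ℝ} (hγ0 : 0 ≤ γ) (hγ1 : γ < 1) {D : S → A → ℝ}
    (hD : ∀ s a, γ * ∑ s', P s a s' * ∑ a', β s' a' * D s' a' ≤ D s a) (s : S) (a : A) :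
    0 ≤ D s a := by
  have : Nonempty (S × A) := ⟨(s, a)⟩
  obtain ⟨⟨s₀, a₀⟩, hmin⟩ := Finite.exists_min fun x : S × A ↦ D x.1 x.2
  have hβD (s' : S) : D s₀ a₀ ≤ ∑ a', β s' a' * D s' a' := by
    calc D s₀ a₀ = ∑ a', β s' a' * D s₀ a₀ := by rw [← Finset.sum_mul, hβ1, one_mul]
      _ ≤ _ := Finset.sum_le_sum fun a' _ ↦
        mul_le_mul_of_nonneg_left (hmin (s', a')) (hβ0 s' a')
  have hPD : D s₀ a₀ ≤ ∑ s', P s₀ a₀ s' * ∑ a', β s' a' * D s' a' := by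
    calc D s₀ a₀ = ∑ s', P s₀ a₀ s' * D s₀ a₀ := by rw [← Finset.sum_mul, hP1, one_mul]
      _ ≤ _ := Finset.sum_le_sum fun s' _ ↦
        mul_le_mul_of_nonneg_left (hβD s') (hP0 s₀ a₀ s')
  have h₀ : 0 ≤ D s₀ a₀ := by
    have := (mul_le_mul_of_nonneg_left hPD hγ0).trans (hD s₀ a₀)
    nlinarith
  exact h₀.trans (hmin (s, a))

/-- Comparison principle for the discounted Bellman evaluation equation. -/
theorem le_of_discounted_fixed_points
    {S A : Type*} [Fintype S] [Fintype A]
    {P : S → A → S → ℝ} (hP0 : ∀ s a s', 0 ≤ P s a s') (hP1 : ∀ s a, ∑ s', P s a s' = 1)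
    {β : S → A → ℝ} (hβ0 : ∀ s a, 0 ≤ β s a) (hβ1 : ∀ s, ∑ a, β s a = 1)
    {γ : ℝ} (hγ0 : 0 ≤ γ) (hγ1 : γ < 1) {r F G : S → A → ℝ}
    (hF : ∀ s a, F s a = r s a + γ * ∑ s', P s a s' * ∑ a', β s' a' * F s' a')
    (hG : ∀ s a, G s a = r s a + γ * ∑ s', P s a s' * ∑ a', β s' a' * G s' a')
    (s : S) (a : A) : F s a ≤ G s a := by
  refine sub_nonneg.mp (nonneg_of_discounted_average_le hP0 hP1 hβ0 hβ1 hγ0 hγ1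
    (D := fun s a ↦ G s a - F s a) (fun s a ↦ ?_) s a)
  simp only [mul_sub, Finset.sum_sub_distrib]
  linarith [hF s a, hG s a]

/-- Theorem 3 (actor-equivalence part, goal-conditioned C-learning):
critic-regularized C-learning yields the same actor objective as
goal-conditioned one-step RL with a reverse-KL penalty toward the marginal
behavioral policy. -/
theorem goal_conditioned_one_step_rl_eq_critic_regularization
    {S A : Type*} [Fintype S] [Fintype A] [Nonempty S] [Nonempty A]
    (P : S → A → S → ℝ) (hP0 : ∀ s a s', 0 ≤ P s a s')
    (hP1 : ∀ s a, ∑ s', P s a s' = 1)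
    (hPpos : ∀ s a g, 0 < P s a g)
    (β : S → A → ℝ) (hβ0 : ∀ s a, 0 < β s a) (hβ1 : ∀ s, ∑ a, β s a = 1)
    (π : S → S → A → ℝ) (hπ0 : ∀ g s a, 0 < π g s a) (hπ1 : ∀ g s, ∑ a, π g s a = 1)
    (γ : ℝ) (hγ0 : 0 ≤ γ) (hγ1 : γ < 1)
    (Qβ : S × A × S → ℝ)
    (hQβ : ∀ s a g, Qβ (s, a, g) =
      (1 - γ) * P s a g + γ * ∑ s', P s a s' * ∑ a', β s' a' * Qβ (s', a', g))
    (Qstar : S × A × S → ℝ)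
    (hQstar : ∀ s a g, Qstar (s, a, g) =
      ((1 - γ) * P s a g + γ * ∑ s', P s a s' * ∑ a', π g s' a' * Qstar (s', a', g))
        * (β s a / π g s a)) :
    ∀ s g, ∑ a, π g s a * Real.log (Qstar (s, a, g)) =
      ∑ a, π g s a *
        (Real.log (Qβ (s, a, g)) + Real.log (β s a) - Real.log (π g s a)) := by
  intro s g
  have hβ0' (s : S) (a : A) : 0 ≤ β s a := (hβ0 s a).le
  have hr (s : S) (a : A) : 0 < (1 - γ) * P s a g := mul_pos (sub_pos.mpr hγ1) (hPpos s a g)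
  have hQβ_nonneg := nonneg_of_discounted_average_le hP0 hP1 hβ0' hβ1 hγ0 hγ1
    (D := fun s a ↦ Qβ (s, a, g)) fun s a ↦ by linarith [hQβ s a g, hr s a]
  have hQβ_pos (s : S) (a : A) : 0 < Qβ (s, a, g) := by
    rw [hQβ]
    exact add_pos_of_pos_of_nonneg (hr s a) <| mul_nonneg hγ0 <|
      Finset.sum_nonneg fun s' _ ↦ mul_nonneg (hP0 s a s') <|
        Finset.sum_nonneg fun a' _ ↦ mul_nonneg (hβ0' s' a') (hQβ_nonneg s' a')
  have hweight (s : S) (a : A) :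
      β s a * (Qstar (s, a, g) * (π g s a / β s a)) = π g s a * Qstar (s, a, g) := by
    have := (hβ0 s a).ne'
    field_simp
  have hreweighted (s : S) (a : A) : Qstar (s, a, g) * (π g s a / β s a) =
      (1 - γ) * P s a g + γ * ∑ s', P s a s' *
        ∑ a', β s' a' * (Qstar (s', a', g) * (π g s' a' / β s' a')) := by
    simp only [hweight]
    rw [hQstar s a g, mul_assoc, div_mul_div_cancel₀ (hπ0 g s a).ne', div_self (hβ0 s a).ne',
      mul_one]
  have heq (a : A) : Qstar (s, a, g) * (π g s a / β s a) = Qβ (s, a, g) :=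
    le_antisymm
      (le_of_discounted_fixed_points hP0 hP1 hβ0' hβ1 hγ0 hγ1
        (F := fun s a ↦ Qstar (s, a, g) * (π g s a / β s a)) (G := fun s a ↦ Qβ (s, a, g))
        hreweighted (fun s a ↦ hQβ s a g) s a)
      (le_of_discounted_fixed_points hP0 hP1 hβ0' hβ1 hγ0 hγ1
        (F := fun s a ↦ Qβ (s, a, g)) (G := fun s a ↦ Qstar (s, a, g) * (π g s a / β s a))
        (fun s a ↦ hQβ s a g) hreweighted s a)
  refine Finset.sum_congr rfl fun a _ ↦ ?_
  have hβ := (hβ0 s a).ne'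
  have hπ := (hπ0 g s a).ne'
  have hQstar_eq : Qstar (s, a, g) = Qβ (s, a, g) * β s a / π g s a := by
    rw [← heq a]
    field_simp
  rw [hQstar_eq, Real.log_div (mul_ne_zero (hQβ_pos s a).ne' hβ) hπ,
    Real.log_mul (hQβ_pos s a).ne' hβ]
end
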